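/- Let r ≥ 1 and let W be a closed subspace of K with S(W) ⊆ W, K_r ⊆ W ⊆ K_{-r}, and dim_ℂ(W ⧸ K_r) = 2r (i.e. W ∈ F_{2r}), and suppose it is not the case that both K_{r-1} ⊆ W and W ⊆ K_{-(r-1)} (i.e. W ∉ F_{2r-2}). Then there exists w ∈ W with w(n) = 0 for all n < -r and all n ≥ r, with w(-r) ≠ 0, and with ⟪w(j), w(-r)⟫ = 0 for all j with -r < j ≤ r-1. Moreover w is unique up to a nonzero complex scalar: any two elements of W with these properties are complex scalar multiples of each other. -/

import Mathlib

noncomputable section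

/-- The Hilbert space `K = ℓ²(ℤ, ℂ²)`, the model of `L²(S¹) ⊗ ℂ²`. -/
abbrev KSp := lp (fun _ : ℤ => EuclideanSpace ℂ (Fin 2)) 2

/-- The closed subspace `K_k = {x ∈ K ∣ x n = 0 for all n < k}`, the model of `z^k K₊`. -/
def Ksub (k : ℤ) : Submodule ℂ KSp where
  carrier := {x : KSp | ∀ n : ℤ, n < k → x n = 0}
  add_mem' := by
    intro a b ha hb n hn
    simp only [Set.mem_setOf_eq] at ha hb
    simp [lp.coeFn_add, Pi.add_apply, ha n hn, hb n hn]
  zero_mem' := by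
    intro n hn
    simp [lp.coeFn_zero]
  smul_mem' := by
    intro c a ha n hn
    simp only [Set.mem_setOf_eq] at ha
    simp [lp.coeFn_smul, Pi.smul_apply, ha n hn]

/-- The closed subspace `K₋ = {x ∈ K ∣ x n = 0 for all n ≥ 0}`. -/
def Kneg : Submodule ℂ KSp where
  carrier := {x : KSp | ∀ n : ℤ, 0 ≤ n → x n = 0}
  add_mem' := by
    intro a b ha hb n hn
    simp only [Set.mem_setOf_eq] at ha hb
    simp [lp.coeFn_add, Pi.add_apply, ha n hn, hb n hn]
  zero_mem' := by
    intro n hn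
    simp [lp.coeFn_zero]
  smul_mem' := by
    intro c a ha n hn
    simp only [Set.mem_setOf_eq] at ha
    simp [lp.coeFn_smul, Pi.smul_apply, ha n hn]


abbrev E2 := EuclideanSpace ℂ (Fin 2)

lemma aux_lin (L : Submodule ℂ E2) (hL : L ≠ ⊤) (u : E2) (hu : u ∈ L) (hu0 : u ≠ 0)
    (z : E2) (hz : z ∈ L) (h : inner ℂ u z = 0) : z = 0 := by
  have h1 : Module.finrank ℂ L < 2 := by
    have := Submodule.finrank_lt hL
    simpa using this
  obtain ⟨v, hv⟩ := finrank_le_one_iff.mp (by omega : Module.finrank ℂ L ≤ 1)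
  obtain ⟨a, ha⟩ := hv ⟨u, hu⟩
  obtain ⟨b, hb⟩ := hv ⟨z, hz⟩
  have ha' : a • (v : E2) = u := congrArg Subtype.val ha
  have hb' : b • (v : E2) = z := congrArg Subtype.val hb
  rw [← ha', ← hb', inner_smul_left, inner_smul_right] at h
  rw [← ha'] at hu0
  have ha0 : a ≠ 0 := fun h => hu0 (by rw [h, zero_smul])
  have hv0 : (v : E2) ≠ 0 := fun h => hu0 (by rw [h, smul_zero])
  have hb0 : b = 0 := by simpa [ha0, hv0] using h
  rw [← hb', hb0, zero_smul]

lemma aux_perp (u : E2) (hu0 : u ≠ 0) : ∃ z : E2, z ≠ 0 ∧ inner ℂ u z = 0 := by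
  refine ⟨!₂[-(starRingEnd ℂ (u 1)), starRingEnd ℂ (u 0)], ?_, ?_⟩
  · intro h
    apply hu0
    have h0 := congrArg (fun x : E2 => x 0) h
    have h1 := congrArg (fun x : E2 => x 1) h
    ext i
    fin_cases i
    · simpa using h1
    · simpa using h0
  · simp [PiLp.inner_apply, Fin.sum_univ_two]
    ring

/-- Leading coefficients at level `k`. -/
def leadSub (W : Submodule ℂ KSp) (k : ℤ) : Submodule ℂ E2 where
  carrier := {z | ∃ y ∈ W, y ∈ Ksub k ∧ y k = z}
  add_mem' := by
    rintro _ _ ⟨y, hy, hy', rfl⟩ ⟨x, hx, hx', rfl⟩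
    exact ⟨y + x, W.add_mem hy hx, Submodule.add_mem _ hy' hx', by simp⟩
  zero_mem' := ⟨0, W.zero_mem, Submodule.zero_mem _, by simp⟩
  smul_mem' := by
    rintro c _ ⟨y, hy, hy', rfl⟩
    exact ⟨c • y, W.smul_mem c hy, Submodule.smul_mem _ c hy', by simp⟩

lemma mem_Ksub {k : ℤ} {x : KSp} : x ∈ Ksub k ↔ ∀ n : ℤ, n < k → x n = 0 := Iff.rfl

lemma aux_shift (S : KSp ≃ₗᵢ[ℂ] KSp) (hS : ∀ (x : KSp) (n : ℤ), (S x) n = x (n - 1))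
    (W : Submodule ℂ KSp) (hSW : ∀ x ∈ W, S x ∈ W) (x : KSp) (hx : x ∈ W) (k : ℕ) :
    ∃ y ∈ W, ∀ n : ℤ, y n = x (n - k) := by
  induction k with
  | zero => exact ⟨x, hx, by simp⟩
  | succ k ih =>
    obtain ⟨y, hy, h⟩ := ih
    refine ⟨S y, hSW y hy, fun n => ?_⟩
    rw [hS, h, show n - 1 - (k : ℤ) = n - ((k + 1 : ℕ) : ℤ) by push_cast; ring]

lemma aux_lead (S : KSp ≃ₗᵢ[ℂ] KSp) (hS : ∀ (x : KSp) (n : ℤ), (S x) n = x (n - 1))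
    (W : Submodule ℂ KSp) (hSW : ∀ x ∈ W, S x ∈ W) (x : KSp) (hx : x ∈ W) (j k : ℤ)
    (hjk : j ≤ k) (hxj : x ∈ Ksub j) : x j ∈ leadSub W k := by
  obtain ⟨m, hm⟩ := Int.eq_ofNat_of_zero_le (sub_nonneg.mpr hjk)
  obtain ⟨y, hy, h⟩ := aux_shift S hS W hSW x hx m
  refine ⟨y, hy, fun n hn => ?_, ?_⟩
  · rw [h]
    exact hxj _ (by omega)
  · rw [h, show k - (m : ℤ) = j by omega]

lemma aux_inj (S : KSp ≃ₗᵢ[ℂ] KSp) (hS : ∀ (x : KSp) (n : ℤ), (S x) n = x (n - 1))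
    (W : Submodule ℂ KSp) (hSW : ∀ x ∈ W, S x ∈ W) (r a : ℤ) (v : E2)
    (hv : ∀ z ∈ leadSub W (r - 1), inner ℂ v z = 0 → z = 0)
    (x : KSp) (hx : x ∈ W) (hxa : x ∈ Ksub a)
    (h : ∀ j : ℤ, a ≤ j → j < r → inner ℂ v (x j) = 0) : x ∈ Ksub r := by
  have key : ∀ k : ℕ, a + k ≤ r → x ∈ Ksub (a + k) := by
    intro k
    induction k with
    | zero => intro _; simpa using hxa
    | succ k ih =>
      intro hk
      push_cast at hk
      have h1 := ih (by omega)
      have h2 := aux_lead S hS W hSW x hx (a + k) (r - 1) (by omega) h1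
      have h3 := hv _ h2 (h _ (by omega) (by omega))
      intro n hn
      push_cast at hn
      rcases eq_or_ne n (a + k) with rfl | hne
      · exact h3
      · exact h1 n (by omega)
  rcases le_total a r with har | har
  · have := key (r - a).toNat (by omega)
    rwa [show a + ((r - a).toNat : ℤ) = r by omega] at this
  · intro n hn
    exact hxa n (by omega)

lemma aux_surj (S : KSp ≃ₗᵢ[ℂ] KSp) (hS : ∀ (x : KSp) (n : ℤ), (S x) n = x (n - 1))
    (W : Submodule ℂ KSp) (hSW : ∀ x ∈ W, S x ∈ W) (a : ℤ) (x₀ : KSp) (hx₀ : x₀ ∈ W)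
    (hxa : x₀ ∈ Ksub a) (h0 : x₀ a ≠ 0) (t : ℤ → ℂ) (k : ℕ) :
    ∃ x ∈ W, ∀ j : ℤ, a ≤ j → j < a + k → inner ℂ (x₀ a) (x j) = t j := by
  induction k with
  | zero => exact ⟨0, W.zero_mem, fun j h1 h2 => by simp at h2; omega⟩
  | succ k ih =>
    obtain ⟨x, hx, h⟩ := ih
    obtain ⟨y, hy, hyn⟩ := aux_shift S hS W hSW x₀ hx₀ k
    have hne : inner ℂ (x₀ a) (x₀ a) ≠ 0 := inner_self_ne_zero.mpr h0
    refine ⟨x + ((t (a + k) - inner ℂ (x₀ a) (x (a + k))) / inner ℂ (x₀ a) (x₀ a)) • y,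
      W.add_mem hx (W.smul_mem _ hy), fun j h1 h2 => ?_⟩
    push_cast at h2
    simp only [lp.coeFn_add, lp.coeFn_smul, Pi.add_apply, Pi.smul_apply, inner_add_right,
      inner_smul_right, hyn]
    rcases eq_or_ne j (a + k) with rfl | hne'
    · rw [show a + (k : ℤ) - k = a by ring, div_mul_cancel₀ _ hne]
      ring
    · rw [hxa (j - k) (by omega), h j h1 (by omega)]
      simp

/-- The coordinates of `x` along `v` at the levels `a, …, a + m - 1`. -/
def phi (v : E2) (a : ℤ) (m : ℕ) : KSp →ₗ[ℂ] (Fin m → ℂ) where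
  toFun x := fun i => inner ℂ v (x (a + (i : ℕ)))
  map_add' x y := by
    ext i
    simp [inner_add_right]
  map_smul' c x := by
    ext i
    simp [inner_smul_right]

lemma phi_apply (v : E2) (a : ℤ) (m : ℕ) (x : KSp) (i : Fin m) :
    phi v a m x i = inner ℂ v (x (a + (i : ℕ))) := rfl

lemma phi_zero (v : E2) (a : ℤ) (m : ℕ) (x : KSp) (h : phi v a m x = 0) (j : ℤ)
    (h1 : a ≤ j) (h2 : j < a + m) : inner ℂ v (x j) = 0 := by
  have := congrFun h ⟨(j - a).toNat, by omega⟩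
  rw [phi_apply] at this
  simp only [Pi.zero_apply] at this
  rwa [show a + ((j - a).toNat : ℤ) = j by omega] at this

lemma aux_trunc (r : ℤ) (x : KSp) (hx : x ∈ Ksub (-r)) :
    ∃ w : KSp, ∀ n : ℤ, w n = if n < r then x n else 0 := by
  refine ⟨∑ j ∈ Finset.Ico (-r) r, lp.single 2 j (x j), fun n => ?_⟩
  rw [lp.coeFn_sum, Finset.sum_apply]
  simp only [lp.single_apply, Pi.single_apply]
  by_cases h1 : n < r
  · rw [if_pos h1]
    by_cases h2 : -r ≤ n
    · rw [Finset.sum_eq_single n]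
      · simp
      · intro b _ hb
        simp [hb.symm]
      · intro h
        simp [h1, h2] at h
    · rw [hx n (by omega)]
      apply Finset.sum_eq_zero
      intro b hb
      have hb := Finset.mem_Ico.mp hb
      rw [if_neg (by omega)]
  · rw [if_neg h1]
    apply Finset.sum_eq_zero
    intro b hb
    have hb := Finset.mem_Ico.mp hb
    rw [if_neg (by omega)]

/-- If `W ∈ F_{2r} \ F_{2r-2}` (with `r ≥ 1`), then `W` contains an element
`w = z^{-r} u₀ + ⋯ + z^{r-1} u_{2r-1}` with `u₀ ≠ 0` and `u_j ⊥ u₀` for `j > 0`, and such a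
`w` is unique up to a nonzero complex scalar. -/
theorem exists_unique_element_of_mem_filtration_diff
    (r : ℕ) (hr : 1 ≤ r)
    (S : KSp ≃ₗᵢ[ℂ] KSp) (hS : ∀ (x : KSp) (n : ℤ), (S x) n = x (n - 1))
    (W : Submodule ℂ KSp) (hWclosed : IsClosed (W : Set KSp))
    (hSW : ∀ x ∈ W, S x ∈ W)
    (hlow : Ksub (r : ℤ) ≤ W) (hhigh : W ≤ Ksub (-(r : ℤ)))
    (hdim : Module.finrank ℂ (↥W ⧸ (Ksub (r : ℤ)).comap W.subtype) = 2 * r)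
    (hnot : ¬ (Ksub ((r : ℤ) - 1) ≤ W ∧ W ≤ Ksub (-((r : ℤ) - 1)))) :
    ∃ w : KSp, w ∈ W ∧
      (∀ n : ℤ, n < -(r : ℤ) → w n = 0) ∧
      (∀ n : ℤ, (r : ℤ) ≤ n → w n = 0) ∧
      w (-(r : ℤ)) ≠ 0 ∧
      (∀ j : ℤ, -(r : ℤ) < j → j ≤ (r : ℤ) - 1 →
        inner (𝕜 := ℂ) (w j) (w (-(r : ℤ))) = 0) ∧
      (∀ w' : KSp, w' ∈ W →
        (∀ n : ℤ, n < -(r : ℤ) → w' n = 0) →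
        (∀ n : ℤ, (r : ℤ) ≤ n → w' n = 0) →
        w' (-(r : ℤ)) ≠ 0 →
        (∀ j : ℤ, -(r : ℤ) < j → j ≤ (r : ℤ) - 1 →
          inner (𝕜 := ℂ) (w' j) (w' (-(r : ℤ))) = 0) →
        ∃ c : ℂ, c ≠ 0 ∧ w' = c • w) := by
  set L := leadSub W ((r : ℤ) - 1) with hLdef
  -- The map induced on the quotient.
  have hfin : Module.Finite ℂ (↥W ⧸ (Ksub (r : ℤ)).comap W.subtype) :=
    Module.finite_of_finrank_pos (by omega)
  have hker : ∀ (v : E2) (a : ℤ) (m : ℕ), a + m ≤ r →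
      (Ksub (r : ℤ)).comap W.subtype ≤ LinearMap.ker ((phi v a m).comp W.subtype) := by
    intro v a m ham x hx
    rw [LinearMap.mem_ker]
    ext i
    have : (x : KSp) (a + (i : ℕ)) = 0 := hx _ (by omega)
    simp [phi_apply, this]
  have hLtop : L = ⊤ → Ksub ((r : ℤ) - 1) ≤ W := by
    intro h x hx
    obtain ⟨y, hy, hy1, hy2⟩ : x ((r : ℤ) - 1) ∈ L := by rw [h]; trivial
    have : x - y ∈ Ksub (r : ℤ) := by
      intro n hn
      rw [lp.coeFn_sub, Pi.sub_apply]
      rcases eq_or_ne n ((r : ℤ) - 1) with rfl | hne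
      · rw [hy2, sub_self]
      · rw [hx n (by omega), hy1 n (by omega), sub_self]
    have := W.add_mem (hlow this) hy
    simpa using this
  have hAor : (∃ x ∈ W, x (-(r : ℤ)) ≠ 0) ∨ L ≠ ⊤ := by
    by_contra! hcon
    obtain ⟨h1, h2⟩ := hcon
    refine hnot ⟨hLtop h2, fun x hx n hn => ?_⟩
    rcases eq_or_ne n (-(r : ℤ)) with rfl | hne
    · exact h1 x hx
    · exact hhigh hx n (by omega)
  have hA : ∃ x ∈ W, x (-(r : ℤ)) ≠ 0 := by
    by_contra! hA
    have hL : L ≠ ⊤ := hAor.resolve_left (by push Not; exact hA)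
    have hv : ∃ v : E2, ∀ z ∈ L, inner ℂ v z = 0 → z = 0 := by
      by_cases hb : L = ⊥
      · exact ⟨0, fun z hz _ => by rw [hb] at hz; exact hz⟩
      · obtain ⟨u, hu, hu0⟩ := L.exists_mem_ne_zero_of_ne_bot hb
        exact ⟨u, fun z hz h => aux_lin L hL u hu hu0 z hz h⟩
    obtain ⟨v, hv⟩ := hv
    let f := Submodule.liftQ _ ((phi v (-(r : ℤ) + 1) (2 * r - 1)).comp W.subtype)
      (hker v _ _ (by omega))
    have hf : Function.Injective f := by
      rw [← LinearMap.ker_eq_bot, Submodule.ker_liftQ_eq_bot']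
      refine le_antisymm (hker v _ _ (by omega)) fun x hx => ?_
      rw [LinearMap.mem_ker] at hx
      refine aux_inj S hS W hSW r (-(r : ℤ) + 1) v hv x x.2 ?_ ?_
      · intro n hn
        rcases eq_or_ne n (-(r : ℤ)) with rfl | hne
        · exact hA x x.2
        · exact hhigh x.2 n (by omega)
      · intro j h1 h2
        exact phi_zero v _ _ x hx j h1 (by omega)
    have := LinearMap.finrank_le_finrank_of_injective hf
    rw [hdim, Module.finrank_fin_fun] at this
    omega
  obtain ⟨x₀, hx₀, hx₀0⟩ := hA
  have hlead : ∀ x ∈ W, x (-(r : ℤ)) ∈ L := fun x hx =>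
    aux_lead S hS W hSW x hx (-(r : ℤ)) _ (by omega) (hhigh hx)
  have hsurj := aux_surj S hS W hSW (-(r : ℤ)) x₀ hx₀ (hhigh hx₀) hx₀0
  have hL : L ≠ ⊤ := by
    intro hL
    let f := Submodule.liftQ _ ((phi (x₀ (-(r : ℤ))) (-(r : ℤ)) (2 * r)).comp W.subtype)
      (hker _ _ _ (by omega))
    have hf : Function.Surjective f := by
      intro t
      obtain ⟨x, hx, h⟩ := hsurj
        (fun j => if h : (j + r).toNat < 2 * r then t ⟨(j + r).toNat, h⟩ else 0) (2 * r)
      refine ⟨Submodule.Quotient.mk ⟨x, hx⟩, ?_⟩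
      ext i
      have hi := i.2
      change inner ℂ (x₀ (-(r : ℤ))) (x (-(r : ℤ) + (i : ℕ))) = t i
      rw [h _ (by omega) (by omega)]
      have : (-(r : ℤ) + (i : ℕ) + r).toNat = i := by omega
      simp only [this]
      simp
    have hinj : Function.Injective f :=
      (LinearMap.injective_iff_surjective_of_finrank_eq_finrank
        (by rw [hdim, Module.finrank_fin_fun])).mpr hf
    obtain ⟨z, hz0, hz⟩ := aux_perp _ hx₀0
    obtain ⟨y, hy, hy1, hy2⟩ : z ∈ L := by rw [hL]; trivial
    have hfy : f (Submodule.Quotient.mk ⟨y, hy⟩) = f 0 := by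
      rw [map_zero]
      ext i
      have hi := i.2
      change inner ℂ (x₀ (-(r : ℤ))) (y (-(r : ℤ) + (i : ℕ))) = 0
      rcases eq_or_ne (-(r : ℤ) + (i : ℕ)) ((r : ℤ) - 1) with he | hne
      · rw [he, hy2, hz]
      · rw [hy1 _ (by omega), inner_zero_right]
    have h1 := hinj hfy
    rw [Submodule.Quotient.mk_eq_zero] at h1
    have h2 : y ((r : ℤ) - 1) = 0 := h1 _ (by omega)
    exact hz0 (hy2 ▸ h2)
  -- Every leading vector is a multiple of any nonzero leading vector.
  have hmul : ∀ u ∈ L, u ≠ 0 → ∀ z ∈ L, ∃ c : ℂ, z = c • u := by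
    intro u hu hu0 z hz
    refine ⟨inner ℂ u z / inner ℂ u u, ?_⟩
    rw [← sub_eq_zero]
    refine aux_lin L hL u hu hu0 _ (L.sub_mem hz (L.smul_mem _ hu)) ?_
    rw [inner_sub_right, inner_smul_right, div_mul_cancel₀ _ (inner_self_ne_zero.mpr hu0),
      sub_self]
  obtain ⟨x, hx, hxt⟩ := hsurj (fun j => if j = -(r : ℤ) then 1 else 0) (2 * r)
  obtain ⟨w, hw⟩ := aux_trunc r x (hhigh hx)
  have hwW : w ∈ W := by
    have : w - x ∈ Ksub (r : ℤ) := by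
      intro n hn
      rw [lp.coeFn_sub, Pi.sub_apply, hw, if_pos hn, sub_self]
    have := W.add_mem (hlow this) hx
    simpa using this
  have hwr : w (-(r : ℤ)) = x (-(r : ℤ)) := by rw [hw, if_pos (by omega)]
  have hw0 : w (-(r : ℤ)) ≠ 0 := by
    intro h
    have := hxt (-(r : ℤ)) le_rfl (by omega)
    rw [← hwr, h] at this
    simp at this
  have hwperp : ∀ j : ℤ, -(r : ℤ) < j → j ≤ (r : ℤ) - 1 →
      inner (𝕜 := ℂ) (w j) (w (-(r : ℤ))) = 0 := by
    intro j h1 h2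
    obtain ⟨c, hc⟩ := hmul _ (hlead x₀ hx₀) hx₀0 _ (hlead w hwW)
    rw [hc, inner_smul_right, inner_eq_zero_symm.mp, mul_zero]
    rw [hw, if_pos (by omega), hxt j (by omega) (by omega), if_neg (by omega)]
  refine ⟨w, hwW, hhigh hwW, fun n hn => by rw [hw, if_neg (by omega)], hw0, hwperp, ?_⟩
  intro w' hw' _ hhi' hw0' hperp'
  obtain ⟨c, hc⟩ := hmul _ (hlead w hwW) hw0 _ (hlead w' hw')
  have hc0 : c ≠ 0 := by
    rintro rfl
    rw [zero_smul] at hc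
    exact hw0' hc
  refine ⟨c, hc0, ?_⟩
  have hd : w' - c • w ∈ Ksub (r : ℤ) := by
    refine aux_inj S hS W hSW r (-(r : ℤ)) (w (-(r : ℤ)))
      (fun z hz h => aux_lin L hL _ (hlead w hwW) hw0 z hz h) _
      (W.sub_mem hw' (W.smul_mem c hwW)) (hhigh (W.sub_mem hw' (W.smul_mem c hwW))) ?_
    intro j h1 h2
    rw [lp.coeFn_sub, Pi.sub_apply, lp.coeFn_smul, Pi.smul_apply]
    rcases eq_or_ne j (-(r : ℤ)) with rfl | hne
    · rw [hc, sub_self, inner_zero_right]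
    · have e1 := hperp' j (by omega) (by omega)
      rw [hc, inner_smul_right] at e1
      have e2 := (mul_eq_zero.mp e1).resolve_left hc0
      rw [inner_sub_right, inner_smul_right, inner_eq_zero_symm.mp e2,
        inner_eq_zero_symm.mp (hwperp j (by omega) (by omega)), mul_zero, sub_self]
  ext1
  funext n
  rcases lt_or_ge n (r : ℤ) with hn | hn
  · have := hd n hn
    rw [lp.coeFn_sub, Pi.sub_apply] at this
    exact sub_eq_zero.mp this
  · rw [hhi' n hn, lp.coeFn_smul, Pi.smul_apply, hw, if_neg (by omega), smul_zero]


end
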